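/- (The shadow Φ₁ defining the recursion operator ℛ₁.) Let (u,v) be a smooth solution of the Pavlov–Mikhalev system on ℝ³, let (p,q) be a smooth solution of the tangent system, and let w₁, w₂ : ℝ³ → ℝ be smooth functions satisfying the potential relations ∂_x(w₁) = 2·u_x·p_x + p_y, ∂_y(w₁) = u_y·p_x + u_x·p_y + p_t, ∂_x(w₂) = q_y − v_x·p_x − u_x·q_x, ∂_y(w₂) = q_t − 2·v_y·p_x + v_x·p_y + u_y·q_x − 2·u_x·q_y. Then the pair (φ^u, φ^v) with φ^u = u_x·p − w₁ and φ^v = v_x·p − 2·u_x·q − w₂ satisfies the linearized system: φ^u_yy = φ^u_xt + u_xx·φ^u_y + u_y·φ^u_xx − u_x·φ^u_xy − u_xy·φ^u_x and φ^v_yy = 2·v_x·φ^u_xy − v_xy·φ^u_x + v_xx·φ^u_y − 2·v_y·φ^u_xx + φ^v_xt + 2·u_xy·φ^v_x − 2·u_xx·φ^v_y + u_y·φ^v_xx − u_x·φ^v_xy. -/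

import Mathlib

noncomputable section

/-- Partial derivative with respect to the first coordinate `t`. -/
def Dt (f : ℝ → ℝ → ℝ → ℝ) : ℝ → ℝ → ℝ → ℝ := fun t x y => deriv (fun s => f s x y) t

/-- Partial derivative with respect to the second coordinate `x`. -/
def Dx (f : ℝ → ℝ → ℝ → ℝ) : ℝ → ℝ → ℝ → ℝ := fun t x y => deriv (fun s => f t s y) x

/-- Partial derivative with respect to the third coordinate `y`. -/
def Dy (f : ℝ → ℝ → ℝ → ℝ) : ℝ → ℝ → ℝ → ℝ := fun t x y => deriv (fun s => f t x s) y

/-- `f` is a smooth function on `ℝ³` (given in curried form, coordinates `(t, x, y)`). -/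
def Smooth3 (f : ℝ → ℝ → ℝ → ℝ) : Prop :=
  ContDiff ℝ (⊤ : ℕ∞) (fun p : ℝ × ℝ × ℝ => f p.1 p.2.1 p.2.2)

/-- The Pavlov–Mikhalev equation `u_yy = u_xt − u_x·u_xy + u_y·u_xx`. -/
def PMu (u : ℝ → ℝ → ℝ → ℝ) : Prop :=
  ∀ t x y : ℝ, Dy (Dy u) t x y =
    Dt (Dx u) t x y - Dx u t x y * Dy (Dx u) t x y + Dy u t x y * Dx (Dx u) t x y

/-- The second equation of the two-component Pavlov–Mikhalev system:
`v_yy = v_xt − u_x·v_xy − 2·v_y·u_xx + 2·v_x·u_xy + u_y·v_xx`. -/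
def PMv (u v : ℝ → ℝ → ℝ → ℝ) : Prop :=
  ∀ t x y : ℝ, Dy (Dy v) t x y =
    Dt (Dx v) t x y - Dx u t x y * Dy (Dx v) t x y
      - 2 * Dy v t x y * Dx (Dx u) t x y + 2 * Dx v t x y * Dy (Dx u) t x y
      + Dy u t x y * Dx (Dx v) t x y

/-- First equation of the linearized system applied to `A = φ^u`:
`φ^u_yy = φ^u_xt + u_xx·φ^u_y + u_y·φ^u_xx − u_x·φ^u_xy − u_xy·φ^u_x`. -/
def LinU (u A : ℝ → ℝ → ℝ → ℝ) : Prop :=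
  ∀ t x y : ℝ, Dy (Dy A) t x y =
    Dt (Dx A) t x y + Dx (Dx u) t x y * Dy A t x y + Dy u t x y * Dx (Dx A) t x y
      - Dx u t x y * Dy (Dx A) t x y - Dy (Dx u) t x y * Dx A t x y

/-- Second equation of the linearized system applied to `(A, B) = (φ^u, φ^v)`. -/
def LinV (u v A B : ℝ → ℝ → ℝ → ℝ) : Prop :=
  ∀ t x y : ℝ, Dy (Dy B) t x y =
    2 * Dx v t x y * Dy (Dx A) t x y - Dy (Dx v) t x y * Dx A t x y
      + Dx (Dx v) t x y * Dy A t x y - 2 * Dy v t x y * Dx (Dx A) t x y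
      + Dt (Dx B) t x y + 2 * Dy (Dx u) t x y * Dx B t x y
      - 2 * Dx (Dx u) t x y * Dy B t x y + Dy u t x y * Dx (Dx B) t x y
      - Dx u t x y * Dy (Dx B) t x y

/-- `(A,B)` is a symmetry generating function of the Pavlov–Mikhalev system over `(u,v)`. -/
def IsSymmetry (u v A B : ℝ → ℝ → ℝ → ℝ) : Prop := LinU u A ∧ LinV u v A B

/-- First equation of the tangent system over a solution `(u,v)`:
`p_yy = u_y·p_xx − u_xy·p_x − u_x·p_xy + u_xx·p_y + p_xt`. -/
def TanP (u p : ℝ → ℝ → ℝ → ℝ) : Prop :=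
  ∀ t x y : ℝ, Dy (Dy p) t x y =
    Dy u t x y * Dx (Dx p) t x y - Dy (Dx u) t x y * Dx p t x y
      - Dx u t x y * Dy (Dx p) t x y + Dx (Dx u) t x y * Dy p t x y + Dt (Dx p) t x y

/-- Second equation of the tangent system over a solution `(u,v)`:
`q_yy = 2·v_x·p_xy + v_xx·p_y − v_xy·p_x − 2·v_y·p_xx + 2·u_xy·q_x + u_y·q_xx
  − u_x·q_xy − 2·u_xx·q_y + q_xt`. -/
def TanQ (u v p q : ℝ → ℝ → ℝ → ℝ) : Prop :=
  ∀ t x y : ℝ, Dy (Dy q) t x y =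
    2 * Dx v t x y * Dy (Dx p) t x y + Dx (Dx v) t x y * Dy p t x y
      - Dy (Dx v) t x y * Dx p t x y - 2 * Dy v t x y * Dx (Dx p) t x y
      + 2 * Dy (Dx u) t x y * Dx q t x y + Dy u t x y * Dx (Dx q) t x y
      - Dx u t x y * Dy (Dx q) t x y - 2 * Dx (Dx u) t x y * Dy q t x y
      + Dt (Dx q) t x y

/-- The uncurried form of a function of three real variables. -/
def uncurry3 (f : ℝ → ℝ → ℝ → ℝ) : ℝ × ℝ × ℝ → ℝ := fun p => f p.1 p.2.1 p.2.2

namespace Smooth3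

variable {f g : ℝ → ℝ → ℝ → ℝ}

theorem contDiff (hf : Smooth3 f) : ContDiff ℝ (⊤ : ℕ∞) (uncurry3 f) := hf

theorem hasFDerivAt (hf : Smooth3 f) (z : ℝ × ℝ × ℝ) :
    HasFDerivAt (uncurry3 f) (fderiv ℝ (uncurry3 f) z) z :=
  (hf.contDiff.differentiable (by simp) z).hasFDerivAt

theorem hasDerivAt_t (hf : Smooth3 f) (t x y : ℝ) :
    HasDerivAt (fun s => f s x y) (fderiv ℝ (uncurry3 f) (t, x, y) (1, 0, 0)) t :=
  (hf.hasFDerivAt (t, x, y)).comp_hasDerivAt t (f := fun s : ℝ => (s, x, y))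
    ((hasDerivAt_id t).prodMk (hasDerivAt_const t (x, y)))

theorem uncurry3_Dt (hf : Smooth3 f) :
    uncurry3 (Dt f) = fun z => fderiv ℝ (uncurry3 f) z (1, 0, 0) :=
  funext fun z => (hf.hasDerivAt_t z.1 z.2.1 z.2.2).deriv

protected theorem Dt (hf : Smooth3 f) : Smooth3 (Dt f) := by
  change ContDiff ℝ (⊤ : ℕ∞) (uncurry3 (Dt f))
  rw [hf.uncurry3_Dt]
  exact (hf.contDiff.fderiv_right (by simp)).clm_apply contDiff_const

theorem Dt_add (hf : Smooth3 f) (hg : Smooth3 g) : Dt (f + g) = Dt f + Dt g := by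
  funext t x y
  exact deriv_add (hf.hasDerivAt_t t x y).differentiableAt
    (hg.hasDerivAt_t t x y).differentiableAt

theorem Dt_sub (hf : Smooth3 f) (hg : Smooth3 g) : Dt (f - g) = Dt f - Dt g := by
  funext t x y
  exact deriv_sub (hf.hasDerivAt_t t x y).differentiableAt
    (hg.hasDerivAt_t t x y).differentiableAt

theorem Dt_mul (hf : Smooth3 f) (hg : Smooth3 g) : Dt (f * g) = Dt f * g + f * Dt g := by
  funext t x y
  exact deriv_mul (hf.hasDerivAt_t t x y).differentiableAt
    (hg.hasDerivAt_t t x y).differentiableAt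

theorem hasDerivAt_x (hf : Smooth3 f) (t x y : ℝ) :
    HasDerivAt (fun s => f t s y) (fderiv ℝ (uncurry3 f) (t, x, y) (0, 1, 0)) x :=
  (hf.hasFDerivAt (t, x, y)).comp_hasDerivAt x (f := fun s : ℝ => (t, s, y))
    ((hasDerivAt_const x t).prodMk ((hasDerivAt_id x).prodMk (hasDerivAt_const x y)))

theorem uncurry3_Dx (hf : Smooth3 f) :
    uncurry3 (Dx f) = fun z => fderiv ℝ (uncurry3 f) z (0, 1, 0) :=
  funext fun z => (hf.hasDerivAt_x z.1 z.2.1 z.2.2).deriv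

protected theorem Dx (hf : Smooth3 f) : Smooth3 (Dx f) := by
  change ContDiff ℝ (⊤ : ℕ∞) (uncurry3 (Dx f))
  rw [hf.uncurry3_Dx]
  exact (hf.contDiff.fderiv_right (by simp)).clm_apply contDiff_const

theorem Dx_add (hf : Smooth3 f) (hg : Smooth3 g) : Dx (f + g) = Dx f + Dx g := by
  funext t x y
  exact deriv_add (hf.hasDerivAt_x t x y).differentiableAt
    (hg.hasDerivAt_x t x y).differentiableAt

theorem Dx_sub (hf : Smooth3 f) (hg : Smooth3 g) : Dx (f - g) = Dx f - Dx g := by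
  funext t x y
  exact deriv_sub (hf.hasDerivAt_x t x y).differentiableAt
    (hg.hasDerivAt_x t x y).differentiableAt

theorem Dx_mul (hf : Smooth3 f) (hg : Smooth3 g) : Dx (f * g) = Dx f * g + f * Dx g := by
  funext t x y
  exact deriv_mul (hf.hasDerivAt_x t x y).differentiableAt
    (hg.hasDerivAt_x t x y).differentiableAt

theorem hasDerivAt_y (hf : Smooth3 f) (t x y : ℝ) :
    HasDerivAt (fun s => f t x s) (fderiv ℝ (uncurry3 f) (t, x, y) (0, 0, 1)) y :=
  (hf.hasFDerivAt (t, x, y)).comp_hasDerivAt y (f := fun s : ℝ => (t, x, s))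
    ((hasDerivAt_const y t).prodMk ((hasDerivAt_const y x).prodMk (hasDerivAt_id y)))

theorem uncurry3_Dy (hf : Smooth3 f) :
    uncurry3 (Dy f) = fun z => fderiv ℝ (uncurry3 f) z (0, 0, 1) :=
  funext fun z => (hf.hasDerivAt_y z.1 z.2.1 z.2.2).deriv

protected theorem Dy (hf : Smooth3 f) : Smooth3 (Dy f) := by
  change ContDiff ℝ (⊤ : ℕ∞) (uncurry3 (Dy f))
  rw [hf.uncurry3_Dy]
  exact (hf.contDiff.fderiv_right (by simp)).clm_apply contDiff_const

theorem Dy_add (hf : Smooth3 f) (hg : Smooth3 g) : Dy (f + g) = Dy f + Dy g := by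
  funext t x y
  exact deriv_add (hf.hasDerivAt_y t x y).differentiableAt
    (hg.hasDerivAt_y t x y).differentiableAt

theorem Dy_sub (hf : Smooth3 f) (hg : Smooth3 g) : Dy (f - g) = Dy f - Dy g := by
  funext t x y
  exact deriv_sub (hf.hasDerivAt_y t x y).differentiableAt
    (hg.hasDerivAt_y t x y).differentiableAt

theorem Dy_mul (hf : Smooth3 f) (hg : Smooth3 g) : Dy (f * g) = Dy f * g + f * Dy g := by
  funext t x y
  exact deriv_mul (hf.hasDerivAt_y t x y).differentiableAt
    (hg.hasDerivAt_y t x y).differentiableAt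

theorem fderiv_fderiv_apply_comm (hf : Smooth3 f) (z a b : ℝ × ℝ × ℝ) :
    fderiv ℝ (fun w => fderiv ℝ (uncurry3 f) w a) z b =
      fderiv ℝ (fun w => fderiv ℝ (uncurry3 f) w b) z a := by
  have hd : DifferentiableAt ℝ (fderiv ℝ (uncurry3 f)) z :=
    (hf.contDiff.fderiv_right (m := (⊤ : ℕ∞)) (by simp)).differentiable (by simp) z
  have hs : IsSymmSndFDerivAt ℝ (uncurry3 f) z :=
    hf.contDiff.contDiffAt.isSymmSndFDerivAt
      (by simpa using WithTop.coe_le_coe.2 (le_top : (2 : ℕ∞) ≤ ⊤))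
  rw [fderiv_clm_apply hd (differentiableAt_const a),
    fderiv_clm_apply hd (differentiableAt_const b)]
  simpa using hs.eq b a

theorem Dx_Dy (hf : Smooth3 f) : Dx (Dy f) = Dy (Dx f) := by
  funext t x y
  have hx := congrFun hf.Dy.uncurry3_Dx (t, x, y)
  have hy := congrFun hf.Dx.uncurry3_Dy (t, x, y)
  rw [hf.uncurry3_Dy] at hx
  rw [hf.uncurry3_Dx] at hy
  exact hx.trans ((hf.fderiv_fderiv_apply_comm _ _ _).trans hy.symm)

theorem Dx_Dt (hf : Smooth3 f) : Dx (Dt f) = Dt (Dx f) := by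
  funext t x y
  have hx := congrFun hf.Dt.uncurry3_Dx (t, x, y)
  have ht := congrFun hf.Dx.uncurry3_Dt (t, x, y)
  rw [hf.uncurry3_Dt] at hx
  rw [hf.uncurry3_Dx] at ht
  exact hx.trans ((hf.fderiv_fderiv_apply_comm _ _ _).trans ht.symm)

theorem Dy_Dt (hf : Smooth3 f) : Dy (Dt f) = Dt (Dy f) := by
  funext t x y
  have hy := congrFun hf.Dt.uncurry3_Dy (t, x, y)
  have ht := congrFun hf.Dy.uncurry3_Dt (t, x, y)
  rw [hf.uncurry3_Dt] at hy
  rw [hf.uncurry3_Dy] at ht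
  exact hy.trans ((hf.fderiv_fderiv_apply_comm _ _ _).trans ht.symm)

protected theorem add (hf : Smooth3 f) (hg : Smooth3 g) : Smooth3 (f + g) :=
  ContDiff.add hf hg

protected theorem sub (hf : Smooth3 f) (hg : Smooth3 g) : Smooth3 (f - g) :=
  ContDiff.sub hf hg

protected theorem mul (hf : Smooth3 f) (hg : Smooth3 g) : Smooth3 (f * g) :=
  ContDiff.mul hf hg

theorem two : Smooth3 2 := contDiff_const

end Smooth3

theorem Dt_two : Dt 2 = 0 := by
  funext t x y
  exact deriv_const _ _

theorem Dx_two : Dx 2 = 0 := by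
  funext t x y
  exact deriv_const _ _

theorem Dy_two : Dy 2 = 0 := by
  funext t x y
  exact deriv_const _ _

theorem shadow_Phi1_recursion (u v p q w₁ w₂ : ℝ → ℝ → ℝ → ℝ)
    (hu : Smooth3 u) (hv : Smooth3 v) (hp : Smooth3 p) (hq : Smooth3 q)
    (hw₁ : Smooth3 w₁) (hw₂ : Smooth3 w₂)
    (hPMu : PMu u) (hPMv : PMv u v) (hTanP : TanP u p) (hTanQ : TanQ u v p q)
    (hw₁x : ∀ t x y : ℝ, Dx w₁ t x y = 2 * Dx u t x y * Dx p t x y + Dy p t x y)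
    (hw₁y : ∀ t x y : ℝ, Dy w₁ t x y
      = Dy u t x y * Dx p t x y + Dx u t x y * Dy p t x y + Dt p t x y)
    (hw₂x : ∀ t x y : ℝ, Dx w₂ t x y
      = Dy q t x y - Dx v t x y * Dx p t x y - Dx u t x y * Dx q t x y)
    (hw₂y : ∀ t x y : ℝ, Dy w₂ t x y
      = Dt q t x y - 2 * Dy v t x y * Dx p t x y + Dx v t x y * Dy p t x y
        + Dy u t x y * Dx q t x y - 2 * Dx u t x y * Dy q t x y) :
    IsSymmetry u v
      (fun t x y => Dx u t x y * p t x y - w₁ t x y)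
      (fun t x y => Dx v t x y * p t x y - 2 * Dx u t x y * q t x y - w₂ t x y) := by
  have eu : Dy (Dy u) = Dt (Dx u) - Dx u * Dy (Dx u) + Dy u * Dx (Dx u) := by
    funext t x y; exact hPMu t x y
  have ev : Dy (Dy v) = Dt (Dx v) - Dx u * Dy (Dx v) - 2 * Dy v * Dx (Dx u)
      + 2 * Dx v * Dy (Dx u) + Dy u * Dx (Dx v) := by
    funext t x y; exact hPMv t x y
  have ep : Dy (Dy p) = Dy u * Dx (Dx p) - Dy (Dx u) * Dx p - Dx u * Dy (Dx p)
      + Dx (Dx u) * Dy p + Dt (Dx p) := by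
    funext t x y; exact hTanP t x y
  have eq : Dy (Dy q) = 2 * Dx v * Dy (Dx p) + Dx (Dx v) * Dy p - Dy (Dx v) * Dx p
      - 2 * Dy v * Dx (Dx p) + 2 * Dy (Dx u) * Dx q + Dy u * Dx (Dx q)
      - Dx u * Dy (Dx q) - 2 * Dx (Dx u) * Dy q + Dt (Dx q) := by
    funext t x y; exact hTanQ t x y
  have w₁x : Dx w₁ = 2 * Dx u * Dx p + Dy p := by
    funext t x y; exact hw₁x t x y
  have w₁y : Dy w₁ = Dy u * Dx p + Dx u * Dy p + Dt p := by
    funext t x y; exact hw₁y t x y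
  have w₂x : Dx w₂ = Dy q - Dx v * Dx p - Dx u * Dx q := by
    funext t x y; exact hw₂x t x y
  have w₂y : Dy w₂ = Dt q - 2 * Dy v * Dx p + Dx v * Dy p + Dy u * Dx q
      - 2 * Dx u * Dy q := by
    funext t x y; exact hw₂y t x y
  have eux := congrArg Dx eu
  have evx := congrArg Dx ev
  set A : ℝ → ℝ → ℝ → ℝ := Dx u * p - w₁ with hA
  set B : ℝ → ℝ → ℝ → ℝ := Dx v * p - 2 * Dx u * q - w₂ with hB
  have lu : Dy (Dy A) = Dt (Dx A) + Dx (Dx u) * Dy A + Dy u * Dx (Dx A)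
      - Dx u * Dy (Dx A) - Dy (Dx u) * Dx A := by
    simp (maxDischargeDepth := 8) only [hA, hu, hp, hw₁, w₁x, w₁y,
      Smooth3.two, Smooth3.Dt, Smooth3.Dx, Smooth3.Dy, Smooth3.add, Smooth3.sub,
      Smooth3.mul, Smooth3.Dt_add, Smooth3.Dt_sub, Smooth3.Dt_mul, Smooth3.Dx_add,
      Smooth3.Dx_sub, Smooth3.Dx_mul, Smooth3.Dy_add, Smooth3.Dy_sub, Smooth3.Dy_mul,
      Dt_two, Dx_two, Dy_two, Smooth3.Dx_Dy, Smooth3.Dx_Dt, Smooth3.Dy_Dt, zero_mul,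
      zero_add] at eux ⊢
    linear_combination p * eux - Dx p * eu - Dx u * ep
  have lv : Dy (Dy B) = 2 * Dx v * Dy (Dx A) - Dy (Dx v) * Dx A + Dx (Dx v) * Dy A
      - 2 * Dy v * Dx (Dx A) + Dt (Dx B) + 2 * Dy (Dx u) * Dx B
      - 2 * Dx (Dx u) * Dy B + Dy u * Dx (Dx B) - Dx u * Dy (Dx B) := by
    simp (maxDischargeDepth := 8) only [hA, hB, hu, hv, hp, hq, hw₁, hw₂, w₁x, w₁y, w₂x, w₂y,
      Smooth3.two, Smooth3.Dt, Smooth3.Dx, Smooth3.Dy, Smooth3.add, Smooth3.sub,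
      Smooth3.mul, Smooth3.Dt_add, Smooth3.Dt_sub, Smooth3.Dt_mul, Smooth3.Dx_add,
      Smooth3.Dx_sub, Smooth3.Dx_mul, Smooth3.Dy_add, Smooth3.Dy_sub, Smooth3.Dy_mul,
      Dt_two, Dx_two, Dy_two, Smooth3.Dx_Dy, Smooth3.Dx_Dt, Smooth3.Dy_Dt, zero_mul,
      zero_add] at eux evx ⊢
    linear_combination p * evx - 2 * q * eux + 2 * Dx p * ev - Dx q * eu + 2 * Dx v * ep
      - Dx u * eq
  exact ⟨fun t x y => congrFun (congrFun (congrFun lu t) x) y,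
    fun t x y => congrFun (congrFun (congrFun lv t) x) y⟩
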